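/- arXiv:1811.11019 — 2 statements merged into one kernel-verified Lean document; each statement's English description precedes it below -/
import Mathlib

section
/- For every real ρ ≥ 0, ∫_ℝ ( Φ( x / √(1+ρ²) ) )² · φ(x) dx = 1/2 − (1/π)·arctan( √( (1+ρ²)/(3+ρ²) ) ). Equivalently, if X is a standard normal random variable, the second moment of the win rate random variable Φ(X/√(1+ρ²)) equals 1/2 − (1/π)·arctan√((1+ρ²)/(3+ρ²)). -/
open MeasureTheory Real

/-- The standard normal density. -/
noncomputable def stdNormalPDF (x : ℝ) : ℝ :=
  (1 / Real.sqrt (2 * Real.pi)) * Real.exp (-x^2 / 2)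

/-- The standard normal cumulative distribution function. -/
noncomputable def stdNormalCDF (x : ℝ) : ℝ :=
  ∫ t in Set.Iic x, stdNormalPDF t

theorem stdNormalPDF_eq (x : ℝ) :
    stdNormalPDF x = (1 / √(2 * π)) * exp (-(1 / 2) * x ^ 2) := by
  unfold stdNormalPDF
  congr 2
  ring

theorem stdNormalPDF_nonneg (x : ℝ) : 0 ≤ stdNormalPDF x := by
  unfold stdNormalPDF
  positivity

theorem stdNormalPDF_neg (x : ℝ) : stdNormalPDF (-x) = stdNormalPDF x := by
  simp [stdNormalPDF]

theorem stdNormalPDF_le_one (x : ℝ) : stdNormalPDF x ≤ 1 := by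
  unfold stdNormalPDF
  have h1 : 1 ≤ √(2 * π) := by
    rw [one_le_sqrt]
    linarith [pi_gt_three]
  have h2 : 1 / √(2 * π) ≤ 1 := by
    rw [div_le_one (by positivity)]
    exact h1
  have h3 : exp (-x ^ 2 / 2) ≤ 1 := exp_le_one_iff.2 (by nlinarith [sq_nonneg x])
  exact mul_le_one₀ h2 (exp_pos _).le h3

theorem hasDerivAt_stdNormalPDF (x : ℝ) :
    HasDerivAt stdNormalPDF (-x * stdNormalPDF x) x := by
  unfold stdNormalPDF
  have h : HasDerivAt (fun x : ℝ => -x ^ 2 / 2) (-x) x := by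
    refine ((hasDerivAt_pow 2 x).neg.div_const 2).congr_deriv ?_
    push_cast
    ring
  refine (h.exp.const_mul (1 / √(2 * π))).congr_deriv ?_
  ring

theorem continuous_stdNormalPDF : Continuous stdNormalPDF := by
  unfold stdNormalPDF
  fun_prop

theorem integrable_stdNormalPDF : Integrable stdNormalPDF := by
  rw [funext stdNormalPDF_eq]
  exact (integrable_exp_neg_mul_sq (by norm_num)).const_mul _

theorem integrable_mul_stdNormalPDF : Integrable fun x => x * stdNormalPDF x := by
  convert (integrable_mul_exp_neg_mul_sq (b := 1 / 2) (by norm_num)).const_mul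
    (1 / √(2 * π)) using 2 with x
  rw [stdNormalPDF_eq]
  ring

theorem integral_stdNormalPDF : ∫ x, stdNormalPDF x = 1 := by
  simp_rw [stdNormalPDF_eq]
  rw [integral_const_mul, integral_gaussian, show π / (1 / 2) = 2 * π by ring]
  have : √(2 * π) ≠ 0 := by positivity
  field_simp

theorem stdNormalCDF_nonneg (x : ℝ) : 0 ≤ stdNormalCDF x :=
  integral_nonneg stdNormalPDF_nonneg

theorem stdNormalCDF_le_one (x : ℝ) : stdNormalCDF x ≤ 1 := by
  rw [← integral_stdNormalPDF]
  exact setIntegral_le_integral integrable_stdNormalPDF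
    (Filter.Eventually.of_forall stdNormalPDF_nonneg)

theorem stdNormalCDF_zero : stdNormalCDF 0 = 1 / 2 := by
  have h := integral_comp_neg_Iic 0 stdNormalPDF
  simp_rw [stdNormalPDF_neg, neg_zero, stdNormalPDF_eq] at h
  unfold stdNormalCDF
  simp_rw [stdNormalPDF_eq]
  rw [h, integral_const_mul, integral_gaussian_Ioi, show π / (1 / 2) = 2 * π by ring]
  have : √(2 * π) ≠ 0 := by positivity
  field_simp

theorem hasDerivAt_stdNormalCDF (x : ℝ) :
    HasDerivAt stdNormalCDF (stdNormalPDF x) x := by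
  have h : stdNormalCDF = fun y => (∫ t in (0 : ℝ)..y, stdNormalPDF t) + stdNormalCDF 0 := by
    funext y
    rw [← intervalIntegral.integral_Iic_sub_Iic integrable_stdNormalPDF.integrableOn
      integrable_stdNormalPDF.integrableOn]
    unfold stdNormalCDF
    ring
  rw [h]
  exact (continuous_stdNormalPDF.integral_hasStrictDerivAt 0 x).hasDerivAt.add_const _

theorem continuous_stdNormalCDF : Continuous stdNormalCDF :=
  continuous_iff_continuousAt.2 fun x => (hasDerivAt_stdNormalCDF x).continuousAt

theorem integrable_bounded_mul {f g : ℝ → ℝ} (hf : Continuous f) (hf0 : ∀ x, 0 ≤ f x)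
    (hf1 : ∀ x, f x ≤ 1) (hg : Integrable g) : Integrable fun x => f x * g x := by
  refine hg.norm.mono' (hf.aestronglyMeasurable.mul hg.aestronglyMeasurable)
    (Filter.Eventually.of_forall fun x => ?_)
  rw [norm_mul, norm_of_nonneg (hf0 x)]
  exact mul_le_of_le_one_left (norm_nonneg _) (hf1 x)

theorem integral_stdNormalPDF_sq_mul (a : ℝ) :
    ∫ x, stdNormalPDF (a * x) ^ 2 * stdNormalPDF x = 1 / (2 * π) / √(1 + 2 * a ^ 2) := by
  have h (x : ℝ) : stdNormalPDF (a * x) ^ 2 * stdNormalPDF x =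
      (1 / √(2 * π)) ^ 3 * exp (-((1 + 2 * a ^ 2) / 2) * x ^ 2) := by
    rw [stdNormalPDF_eq, stdNormalPDF_eq, mul_pow, ← exp_nat_mul]
    rw [show -((1 + 2 * a ^ 2) / 2) * x ^ 2 =
      ((2 : ℕ) : ℝ) * (-(1 / 2) * (a * x) ^ 2) + -(1 / 2) * x ^ 2 by push_cast; ring, exp_add]
    ring
  simp_rw [h]
  rw [integral_const_mul, integral_gaussian,
    show π / ((1 + 2 * a ^ 2) / 2) = 2 * π / (1 + 2 * a ^ 2) by field_simp,
    sqrt_div (by positivity)]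
  have h0 : √(2 * π) ≠ 0 := by positivity
  have h1 : √(2 * π) ^ 2 = 2 * π := sq_sqrt (by positivity)
  field_simp
  rw [h1]

theorem integral_stdNormalCDF_mul_stdNormalPDF (a : ℝ) :
    ∫ x, stdNormalCDF (a * x) * stdNormalPDF (a * x) * (x * stdNormalPDF x) =
      a / (1 + a ^ 2) * (1 / (2 * π) / √(1 + 2 * a ^ 2)) := by
  have hΦ := continuous_stdNormalCDF
  have hφ := continuous_stdNormalPDF
  have hu (x : ℝ) : HasDerivAt (fun x => stdNormalCDF (a * x)) (stdNormalPDF (a * x) * a) x :=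
    (hasDerivAt_stdNormalCDF (a * x)).comp x (hasDerivAt_const_mul a)
  have hp (x : ℝ) : HasDerivAt (fun x => stdNormalPDF (a * x))
      (-(a * x) * stdNormalPDF (a * x) * a) x :=
    (hasDerivAt_stdNormalPDF (a * x)).comp x (hasDerivAt_const_mul a)
  have hv (x : ℝ) : HasDerivAt (fun x => stdNormalPDF (a * x) * stdNormalPDF x)
      (-(1 + a ^ 2) * (stdNormalPDF (a * x) * (x * stdNormalPDF x))) x := by
    refine ((hp x).mul (hasDerivAt_stdNormalPDF x)).congr_deriv ?_
    ring
  have ibdd {g : ℝ → ℝ} (hg : Integrable g) : Integrable fun x => stdNormalPDF (a * x) * g x :=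
    integrable_bounded_mul (by fun_prop) (fun _ => stdNormalPDF_nonneg _)
      (fun _ => stdNormalPDF_le_one _) hg
  have ibdd' {g : ℝ → ℝ} (hg : Integrable g) : Integrable fun x => stdNormalCDF (a * x) * g x :=
    integrable_bounded_mul (by fun_prop) (fun _ => stdNormalCDF_nonneg _)
      (fun _ => stdNormalCDF_le_one _) hg
  have key := integral_mul_deriv_eq_deriv_mul_of_integrable (fun x _ => hu x) (fun x _ => hv x)
    (ibdd' ((ibdd integrable_mul_stdNormalPDF).const_mul _))
    (by
      convert (ibdd (ibdd integrable_stdNormalPDF)).const_mul a using 1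
      funext x
      simp only [Pi.mul_apply]
      ring)
    (ibdd' (ibdd integrable_stdNormalPDF))
  have e1 (x : ℝ) : stdNormalCDF (a * x) *
      (-(1 + a ^ 2) * (stdNormalPDF (a * x) * (x * stdNormalPDF x))) =
      -(1 + a ^ 2) * (stdNormalCDF (a * x) * stdNormalPDF (a * x) * (x * stdNormalPDF x)) := by
    ring
  have e2 (x : ℝ) : stdNormalPDF (a * x) * a * (stdNormalPDF (a * x) * stdNormalPDF x) =
      a * (stdNormalPDF (a * x) ^ 2 * stdNormalPDF x) := by
    ring
  simp_rw [e1, e2] at key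
  rw [integral_const_mul, integral_const_mul, integral_stdNormalPDF_sq_mul] at key
  have h0 : 1 + a ^ 2 ≠ 0 := by positivity
  rw [div_mul_eq_mul_div, eq_div_iff h0]
  linarith

theorem hasDerivAt_integral_stdNormalCDF_sq (a : ℝ) :
    HasDerivAt (fun a => ∫ x, stdNormalCDF (a * x) ^ 2 * stdNormalPDF x)
      (a / (1 + a ^ 2) * (1 / π / √(1 + 2 * a ^ 2))) a := by
  have hΦ := continuous_stdNormalCDF
  have hφ := continuous_stdNormalPDF
  have key := (hasDerivAt_integral_of_dominated_loc_of_deriv_le (μ := volume) (x₀ := a)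
    (s := Set.univ) (bound := fun x => 2 * ‖x * stdNormalPDF x‖)
    (F := fun a x => stdNormalCDF (a * x) ^ 2 * stdNormalPDF x)
    (F' := fun a x =>
      2 * (stdNormalCDF (a * x) * stdNormalPDF (a * x) * (x * stdNormalPDF x)))
    Filter.univ_mem
    (Filter.Eventually.of_forall fun b =>
      (by fun_prop : Continuous fun x =>
        stdNormalCDF (b * x) ^ 2 * stdNormalPDF x).aestronglyMeasurable)
    (integrable_bounded_mul (by fun_prop) (fun _ => sq_nonneg _)
      (fun _ => pow_le_one₀ (stdNormalCDF_nonneg _) (stdNormalCDF_le_one _))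
      integrable_stdNormalPDF)
    (by fun_prop : Continuous fun x =>
      2 * (stdNormalCDF (a * x) * stdNormalPDF (a * x) * (x * stdNormalPDF x))).aestronglyMeasurable
    (Filter.Eventually.of_forall fun x b _ => by
      have h0 : 0 ≤ stdNormalCDF (b * x) * stdNormalPDF (b * x) :=
        mul_nonneg (stdNormalCDF_nonneg _) (stdNormalPDF_nonneg _)
      have h1 : stdNormalCDF (b * x) * stdNormalPDF (b * x) ≤ 1 :=
        mul_le_one₀ (stdNormalCDF_le_one _) (stdNormalPDF_nonneg _) (stdNormalPDF_le_one _)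
      rw [norm_mul, norm_mul (_ * _), norm_of_nonneg h0, norm_of_nonneg zero_le_two]
      gcongr
      exact mul_le_of_le_one_left (norm_nonneg _) h1)
    (integrable_mul_stdNormalPDF.norm.const_mul 2)
    (Filter.Eventually.of_forall fun x b _ => by
      have h : HasDerivAt (fun b => stdNormalCDF (b * x)) (stdNormalPDF (b * x) * x) b :=
        HasDerivAt.comp (h₂ := stdNormalCDF) b (hasDerivAt_stdNormalCDF (b * x))
          (hasDerivAt_mul_const x)
      refine ((h.pow 2).mul_const (stdNormalPDF x)).congr_deriv ?_
      push_cast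
      ring)).2
  rw [integral_const_mul, integral_stdNormalCDF_mul_stdNormalPDF] at key
  refine key.congr_deriv ?_
  field_simp

theorem hasDerivAt_arctan_one_div_sqrt (a : ℝ) :
    HasDerivAt (fun a : ℝ => arctan (1 / √(1 + 2 * a ^ 2)))
      (-(a / (1 + a ^ 2) * (1 / √(1 + 2 * a ^ 2)))) a := by
  have hpos : 0 < 1 + 2 * a ^ 2 := by positivity
  have h1 : HasDerivAt (fun a : ℝ => 1 + 2 * a ^ 2) (4 * a) a := by
    refine (((hasDerivAt_pow 2 a).const_mul 2).const_add 1).congr_deriv ?_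
    push_cast
    ring
  have h2 := ((h1.sqrt hpos.ne').fun_inv (sqrt_ne_zero'.2 hpos)).arctan
  simp only [one_div]
  refine h2.congr_deriv ?_
  rw [inv_pow, sq_sqrt hpos.le]
  have hs : √(1 + 2 * a ^ 2) ≠ 0 := sqrt_ne_zero'.2 hpos
  have h3 : 1 + 2 * a ^ 2 + 1 ≠ 0 := by positivity
  field_simp
  ring

theorem integral_stdNormalCDF_sq (a : ℝ) :
    ∫ x, stdNormalCDF (a * x) ^ 2 * stdNormalPDF x =
      1 / 2 - (1 / π) * arctan (1 / √(1 + 2 * a ^ 2)) := by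
  have hd (b : ℝ) := (hasDerivAt_integral_stdNormalCDF_sq b).add
    ((hasDerivAt_arctan_one_div_sqrt b).const_mul (1 / π))
  have hc := is_const_of_deriv_eq_zero (fun b => (hd b).differentiableAt)
    (fun b => (hd b).deriv.trans (by ring)) a 0
  simp only [Pi.add_apply, zero_mul, stdNormalCDF_zero, integral_const_mul,
    integral_stdNormalPDF] at hc
  norm_num [arctan_one] at hc
  have hπ : π⁻¹ * (π / 4) = 1 / 4 := by field_simp
  rw [hπ] at hc
  simp only [one_div]
  linarith

/-- Second moment of a win rate random variable:
`∫ (Φ(x/√(1+ρ²)))² φ(x) dx = 1/2 − (1/π) arctan √((1+ρ²)/(3+ρ²))`. -/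
theorem winrate_second_moment (ρ : ℝ) (hρ : 0 ≤ ρ) :
    (∫ x : ℝ, (stdNormalCDF (x / Real.sqrt (1 + ρ^2)))^2 * stdNormalPDF x)
      = 1/2 - (1/Real.pi) * Real.arctan (Real.sqrt ((1 + ρ^2) / (3 + ρ^2))) := by
  have h1 : 0 < 1 + ρ ^ 2 := by positivity
  have h := integral_stdNormalCDF_sq (1 / √(1 + ρ ^ 2))
  simp_rw [one_div_mul_eq_div] at h
  have harg : 1 / (1 + 2 * (1 / √(1 + ρ ^ 2)) ^ 2) = (1 + ρ ^ 2) / (3 + ρ ^ 2) := by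
    rw [div_pow, sq_sqrt h1.le]
    field_simp
    ring
  rw [h, ← harg, sqrt_div zero_le_one, sqrt_one, one_div_mul_eq_div]
end

section
/- For every real a ≥ 0, ∫_0^a 1 / ( (1+u²)·√(2+u²) ) du = arctan( a / √(2+a²) ). -/
/-- The function `x ↦ arctan (x / √(2 + x²))` is an antiderivative of
`x ↦ 1 / ((1 + x²) √(2 + x²))`. -/
theorem hasDerivAt_arctan_div_sqrt_two_add_sq (x : ℝ) :
    HasDerivAt (fun u : ℝ => Real.arctan (u / Real.sqrt (2 + u^2)))
      (1 / ((1 + x^2) * Real.sqrt (2 + x^2))) x := by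
  have hpos : 0 < 2 + x^2 := by positivity
  have hs : 0 < Real.sqrt (2 + x^2) := Real.sqrt_pos.2 hpos
  have hsq : Real.sqrt (2 + x^2) ^ 2 = 2 + x^2 := Real.sq_sqrt hpos.le
  have hsqrt : HasDerivAt (fun u : ℝ => Real.sqrt (2 + u^2)) (x / Real.sqrt (2 + x^2)) x := by
    convert ((hasDerivAt_pow 2 x).const_add 2).sqrt hpos.ne' using 1
    field_simp
    norm_num [mul_comm]
  have hden : 1 + (x / Real.sqrt (2 + x^2)) ^ 2 = 2 * (1 + x^2) / (2 + x^2) := by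
    rw [div_pow, hsq]
    field_simp
    ring
  have hnum : 1 * Real.sqrt (2 + x^2) - x * (x / Real.sqrt (2 + x^2))
      = 2 / Real.sqrt (2 + x^2) := by
    field_simp
    rw [hsq]
    ring
  refine ((hasDerivAt_id' x).div hsqrt hs.ne').arctan.congr_deriv ?_
  simp only [Pi.div_apply]
  rw [hden, hnum, hsq]
  field_simp

/-- For every `a ≥ 0`, `∫₀^a du/((1+u²)√(2+u²)) = arctan(a/√(2+a²))`. -/
theorem integral_one_div_one_add_sq_mul_sqrt (a : ℝ) (ha : 0 ≤ a) :
    ∫ u in (0:ℝ)..a, 1 / ((1 + u^2) * Real.sqrt (2 + u^2))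
      = Real.arctan (a / Real.sqrt (2 + a^2)) := by
  have hcont : Continuous fun u : ℝ => 1 / ((1 + u^2) * Real.sqrt (2 + u^2)) := by
    refine continuous_const.div (by fun_prop) fun u => ?_
    positivity
  rw [intervalIntegral.integral_eq_sub_of_hasDerivAt
    (fun x _ => hasDerivAt_arctan_div_sqrt_two_add_sq x) (hcont.intervalIntegrable 0 a)]
  simp
end
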